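/- arXiv:2403.04230 — 2 statements merged into one kernel-verified Lean document; each statement's English description precedes it below -/
import Mathlib

section
/- Let ε ∈ (0,1], c = 1000, L = 10^15, and γ = ε⁴/L. Let p_i, q_i, p_S, q_S, t be positive reals satisfying: p_i ≥ (1 + ε/4)·q_i; q_S > p_S/(1 + 150ε/c); p_S/p_i ≤ q_S/q_i; p_S ≥ t·ε/9; q_S ≤ 200·t; and c²·p_i/ε³ ≤ t < 2·c²·p_i/ε³. Then | p_i/(p_i + p_S) − q_i/(q_i + q_S) | > 4γ. -/
/-- Final inequality chain in the proof of Lemma 4.8: under the stated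
conditions, `|p_i/(p_i+p_S) − q_i/(q_i+q_S)| > 4γ` with `γ = ε⁴/10¹⁵`. -/
theorem stmt_9 (ε pi qi pS qS t : ℝ) (hε : ε ∈ Set.Ioc (0:ℝ) 1)
    (hpi : 0 < pi) (hqi : 0 < qi) (hpS : 0 < pS) (hqS : 0 < qS) (ht : 0 < t)
    (h1 : (1 + ε/4) * qi ≤ pi)
    (h2 : pS / (1 + 150 * ε / 1000) < qS)
    (h3 : pS / pi ≤ qS / qi)
    (h4 : t * ε / 9 ≤ pS)
    (h5 : qS ≤ 200 * t)
    (h6 : 1000 ^ 2 * pi / ε ^ 3 ≤ t) (h7 : t < 2 * 1000 ^ 2 * pi / ε ^ 3) :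
    4 * (ε ^ 4 / 10 ^ 15) < |pi / (pi + pS) - qi / (qi + qS)| := by
  obtain ⟨hε0, hε1⟩ := hε
  have hε3 : 0 < ε ^ 3 := by positivity
  have hε3_le : ε ^ 3 ≤ ε := by
    simpa using pow_le_pow_of_le_one hε0.le hε1 (show 1 ≤ 3 by norm_num)
  rw [div_lt_iff₀ (by positivity)] at h2
  rw [div_le_iff₀ hε3] at h6
  rw [lt_div_iff₀ hε3] at h7
  have hqi_le : qi ≤ pi := by nlinarith [mul_pos hε0 hqi]
  have hpS_le : pS ≤ 115 / 100 * qS := by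
    nlinarith [mul_nonneg hqS.le (sub_nonneg.2 hε1)]
  have htε : t * ε ^ 3 ≤ t * ε := mul_le_mul_of_nonneg_left hε3_le ht.le
  have htε' : t * ε ≤ t := mul_le_of_le_one_right ht.le hε1
  have hpi_le : pi ≤ t := by linarith
  have hqi_qS : qi ≤ qS := by linarith
  have hden : (pi + pS) * (qi + qS) ≤ (231 * t) * (2 * qS) :=
    mul_le_mul (by linarith) (by linarith) (by positivity) (by positivity)
  have hgap : qi * (1 + 150 * ε / 1000) ≤ pi * (1 - 8 / 100 * ε) := by
    have hmul := mul_le_mul_of_nonneg_right h1 (show 0 ≤ 1 - 8 / 100 * ε by linarith)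
    have hslack : 0 ≤ qi * (ε * (1 - ε)) :=
      mul_nonneg hqi.le (mul_nonneg hε0.le (by linarith))
    linarith
  have hnum : 8 / 100 * ε * pi * qS ≤ pi * qS - qi * pS := by
    have hqipS := mul_le_mul_of_nonneg_left h2.le hqi.le
    have hgapS := mul_le_mul_of_nonneg_right hgap hqS.le
    linarith
  have hpos : 0 < ε * pi * qS := by positivity
  refine lt_of_lt_of_le ?_ (le_abs_self _)
  rw [div_sub_div _ _ (by positivity) (by positivity), lt_div_iff₀ (by positivity)]
  have hscaled := mul_le_mul_of_nonneg_left hden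
    (show 0 ≤ 4 * (ε ^ 4 / 10 ^ 15) by positivity)
  have htS := mul_le_mul_of_nonneg_right h7.le (show 0 ≤ ε * qS by positivity)
  linarith
end

section
/- Let ε ∈ (0,1], c = 1000, L = 10^15, γ = ε⁴/L, and t ∈ (0,1]. Let R_P, R_Q, A, B, P_S, Q_S be positive reals satisfying: R_P ≥ ε/9; R_Q ≥ ε/10; |A − t·R_P| ≤ 8·t·ε·√(ε·R_P)/c; |B − t·R_Q| ≤ 8·t·ε·√(ε·R_Q)/c; |A − B| ≤ 20·t·ε·√(ε·min(R_P, R_Q))/c; t·ε/9 ≤ P_S ≤ 200·t; Q_S ≤ 200·t; and |A/P_S − B/Q_S| ≤ 4γ. Then Q_S > P_S/(1 + 150ε/c). -/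
/-- Claim 4.11 of the paper, stated as a real-number lemma. -/
theorem stmt_13 (ε t RP RQ A B PS QS : ℝ) (hε : ε ∈ Set.Ioc (0:ℝ) 1)
    (ht : t ∈ Set.Ioc (0:ℝ) 1)
    (hRP : 0 < RP) (hRQ : 0 < RQ) (hA : 0 < A) (hB : 0 < B)
    (hPS : 0 < PS) (hQS : 0 < QS)
    (hRP1 : ε / 9 ≤ RP) (hRQ1 : ε / 10 ≤ RQ)
    (hAconc : |A - t * RP| ≤ 8 * t * ε * Real.sqrt (ε * RP) / 1000)
    (hBconc : |B - t * RQ| ≤ 8 * t * ε * Real.sqrt (ε * RQ) / 1000)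
    (hAB : |A - B| ≤ 20 * t * ε * Real.sqrt (ε * min RP RQ) / 1000)
    (hPS1 : t * ε / 9 ≤ PS) (hPS2 : PS ≤ 200 * t) (hQS2 : QS ≤ 200 * t)
    (hTP : |A / PS - B / QS| ≤ 4 * (ε ^ 4 / 10 ^ 15)) :
    PS / (1 + 150 * ε / 1000) < QS := by
  obtain ⟨hε0, hε1⟩ := hε
  obtain ⟨ht0, -⟩ := ht
  have hsqrt : Real.sqrt (ε * RQ) ≤ 4 * RQ :=
    Real.sqrt_le_iff.mpr ⟨by positivity, by nlinarith⟩
  have hsqrt_min : Real.sqrt (ε * min RP RQ) ≤ 4 * RQ :=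
    (Real.sqrt_le_sqrt (mul_le_mul_of_nonneg_left (min_le_right _ _) hε0.le)).trans hsqrt
  have htε : 0 < t * ε := mul_pos ht0 hε0
  have htRQ : 0 < t * RQ := mul_pos ht0 hRQ
  have hB_lower : 968 / 1000 * (t * RQ) ≤ B := by
    have h := mul_le_mul_of_nonneg_left hsqrt htε.le
    have h' := mul_le_mul_of_nonneg_left hε1 htRQ.le
    linarith [(abs_le.mp hBconc).1]
  have hA_upper : A - B ≤ 80 / 1000 * (ε * (t * RQ)) := by
    have h := mul_le_mul_of_nonneg_left hsqrt_min htε.le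
    linarith [(abs_le.mp hAB).2]
  by_contra! hQ
  have hden : 0 < 1 + 150 * ε / 1000 := by positivity
  rw [le_div_iff₀ hden] at hQ
  have hratio : B * (1 + 150 * ε / 1000) / PS ≤ B / QS := by
    rw [div_le_div_iff₀ hPS hQS]
    linarith [mul_le_mul_of_nonneg_left hQ hB.le]
  have hgap : B * (1 + 150 * ε / 1000) - A ≤ 4 * (ε ^ 4 / 10 ^ 15) * PS := by
    rw [← div_le_iff₀ hPS, sub_div]
    linarith [(abs_le.mp hTP).1]
  have hgap_upper : 4 * (ε ^ 4 / 10 ^ 15) * PS ≤ 4 * (ε ^ 2 / 10 ^ 15) * (200 * t) := by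
    have hpow : ε ^ 4 ≤ ε ^ 2 := pow_le_pow_of_le_one hε0.le hε1 (by norm_num)
    gcongr
  have hεB := mul_le_mul_of_nonneg_left hB_lower hε0.le
  have hεRQ := mul_le_mul_of_nonneg_left hRQ1 htε.le
  have hpos : 0 < t * ε ^ 2 := by positivity
  linarith
end
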